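/- arXiv:1107.3365 — 2 statements merged into one kernel-verified Lean document; each statement's English description precedes it below -/
import Mathlib

section
/- Let X_1, X_2, … be a sequence of real-valued random variables, and suppose there are constants A > 0, a > 0, b ≥ 0 and γ ∈ (0,2) such that for all integers m ≥ 0, n ≥ 1 and all reals t ≥ 0, P{|S(m+1, m+n)| > t} ≤ A·exp(−a t² / (n + b t^γ)). Then with probability 1, limsup_{n→∞} |S(1,n)| / √(n · log log n) ≤ 1/√a. -/
open MeasureTheory Finset Filter

namespace BoundedLIL

/-- If a sequence of partial sums `S` varies by at most `(3/4)^i * u` over every dyadic block of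
level `i > L` inside `[2^r, 2^(r+1))`, and is at most `v` at the dyadic points of level `L`,
then it is at most `v + 3 * (3/4)^L * u` on all of `[2^r, 2^(r+1))`. -/
lemma abs_le_of_dyadic_increments (S : ℕ → ℝ) {L r n : ℕ} {u v : ℝ} (hu : 0 ≤ u) (hLr : L ≤ r)
    (hn : 2 ^ r ≤ n) (hn' : n < 2 ^ (r + 1))
    (hanchor : |S (n / 2 ^ (r - L) * 2 ^ (r - L))| ≤ v)
    (hblock : ∀ i, L < i → i ≤ r → ∀ p ∈ Finset.Ico (2 ^ i) (2 ^ (i + 1)),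
      |S (p * 2 ^ (r - i) + 2 ^ (r - i)) - S (p * 2 ^ (r - i))| ≤ (3 / 4) ^ i * u) :
    |S n| ≤ v + 3 * (3 / 4) ^ L * u := by
  have key : ∀ i, L ≤ i → i ≤ r →
      |S (n / 2 ^ (r - i) * 2 ^ (r - i))| ≤ v + 3 * ((3 / 4) ^ L - (3 / 4) ^ i) * u := by
    intro i hi
    induction i, hi using Nat.le_induction with
    | base => intro _; simpa using hanchor
    | succ i hi ih =>
      intro hir
      have ih := ih (by omega)
      have hri : r - i = (r - (i + 1)) + 1 := by omega
      set j := r - (i + 1) with hj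
      have hdiv : n / 2 ^ (j + 1) = n / 2 ^ j / 2 := by rw [pow_succ, Nat.div_div_eq_div_mul]
      have hr : r = i + 1 + j := by omega
      have hlow : 2 ^ (i + 1) ≤ n / 2 ^ j := by
        rw [Nat.le_div_iff_mul_le (by positivity), ← pow_add, ← hr]; exact hn
      have hup : n / 2 ^ j < 2 ^ (i + 2) := by
        rw [Nat.div_lt_iff_lt_mul (by positivity), ← pow_add]
        convert hn' using 2; omega
      have hup0 : (0 : ℝ) ≤ (3 / 4) ^ i * u := by positivity
      rw [hri, hdiv] at ih
      obtain h2 | h2 := Nat.mod_two_eq_zero_or_one (n / 2 ^ j)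
      · have he : n / 2 ^ j / 2 * 2 ^ (j + 1) = n / 2 ^ j * 2 ^ j := by
          rw [pow_succ, mul_comm (2 ^ j) 2, ← mul_assoc]; congr 1; omega
        rw [he] at ih
        rw [pow_succ]
        nlinarith
      · have he : n / 2 ^ j / 2 * 2 ^ (j + 1) = (n / 2 ^ j - 1) * 2 ^ j := by
          rw [pow_succ, mul_comm (2 ^ j) 2, ← mul_assoc]; congr 1; omega
        rw [he] at ih
        have hb := hblock (i + 1) (by omega) hir (n / 2 ^ j - 1) (by
          have h2i : 2 ^ (i + 1) = 2 * 2 ^ i := by ring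
          exact Finset.mem_Ico.2 ⟨by omega, (Nat.sub_le _ _).trans_lt hup⟩)
        rw [← hj] at hb
        have he2 : (n / 2 ^ j - 1) * 2 ^ j + 2 ^ j = n / 2 ^ j * 2 ^ j := by
          rw [← Nat.succ_mul, Nat.succ_eq_add_one,
            Nat.sub_add_cancel (Nat.one_le_two_pow.trans hlow)]
        rw [he2] at hb
        have := abs_sub_abs_le_abs_sub (S (n / 2 ^ j * 2 ^ j)) (S ((n / 2 ^ j - 1) * 2 ^ j))
        rw [pow_succ] at hb ⊢
        nlinarith
  have h := key r hLr le_rfl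
  simp only [Nat.sub_self, pow_zero, Nat.div_one, mul_one] at h
  have : (0 : ℝ) ≤ (3 / 4) ^ r * u := by positivity
  nlinarith

/-- The Bernstein exponent of a dyadic block of level `i` of `[2^r, 2^(r+1))`. -/
lemma block_exponent {a b γ η : ℝ} (hb : 0 ≤ b) (hγ2 : γ < 2) (ha : 0 < a)
    (hη : η = (9 / 8 : ℝ) ^ (1 - γ / 2)) {r i : ℕ} (hir : i ≤ r) (hl : 1 ≤ Real.log r)
    (hi : (2 + i : ℝ) ≤ a / 2 * (9 / 8) ^ i)
    (hr : (2 + r : ℝ) * Real.log r * b ≤ a / 2 * η ^ r) :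
    (2 + i : ℝ) * Real.log r ≤ a * ((3 / 4) ^ i * √(2 ^ r * Real.log r)) ^ 2 /
      (((2 ^ (r - i) : ℕ) : ℝ) + b * ((3 / 4) ^ i * √(2 ^ r * Real.log r)) ^ γ) := by
  set l := Real.log r
  set t := (3 / 4 : ℝ) ^ i * √(2 ^ r * l) with ht
  have ht0 : 0 < t := by positivity
  have hpow : (2 : ℝ) ^ r = 2 ^ i * 2 ^ (r - i) := by rw [← pow_add]; congr 1; omega
  have ht2' : t ^ 2 = (9 / 16) ^ i * (2 ^ r * l) := by
    rw [ht, mul_pow, Real.sq_sqrt (by positivity), ← pow_mul, mul_comm i 2, pow_mul]; norm_num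
  have ht2 : t ^ 2 = (9 / 8) ^ i * 2 ^ (r - i) * l := by
    rw [ht2', hpow, show (9 / 8 : ℝ) = 9 / 16 * 2 by norm_num, mul_pow]; ring
  have hge : (9 / 8 : ℝ) ^ r ≤ t ^ 2 := by
    rw [ht2', show (9 / 8 : ℝ) = 9 / 16 * 2 by norm_num, mul_pow]
    have h1 : (9 / 16 : ℝ) ^ r ≤ (9 / 16) ^ i :=
      pow_le_pow_of_le_one (by norm_num) (by norm_num) hir
    have h2 : (2 : ℝ) ^ r ≤ 2 ^ r * l := le_mul_of_one_le_right (by positivity) hl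
    gcongr
  have hηt : η ^ r ≤ t ^ (2 - γ) := by
    have h1 : t ^ (2 - γ) = (t ^ 2) ^ (1 - γ / 2) := by
      rw [← Real.rpow_natCast t 2, ← Real.rpow_mul ht0.le]; congr 1; push_cast; ring
    rw [h1, hη, ← Real.rpow_natCast, ← Real.rpow_mul (by norm_num), mul_comm,
      Real.rpow_mul (by norm_num),
      Real.rpow_natCast]
    exact Real.rpow_le_rpow (by positivity) hge (by linarith)
  have hsplit : t ^ 2 = t ^ (2 - γ) * t ^ γ := by
    rw [← Real.rpow_add ht0, ← Real.rpow_natCast]; congr 1; push_cast; ring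
  have htγ : 0 < t ^ γ := Real.rpow_pos_of_pos ht0 γ
  rw [le_div_iff₀ (by positivity)]
  push_cast
  have e1 : (2 + i : ℝ) * l * 2 ^ (r - i) ≤ a / 2 * t ^ 2 := by
    rw [ht2]
    calc (2 + i : ℝ) * l * 2 ^ (r - i) ≤ (a / 2 * (9 / 8) ^ i) * l * 2 ^ (r - i) := by gcongr
      _ = _ := by ring
  have e2 : (2 + i : ℝ) * l * (b * t ^ γ) ≤ a / 2 * t ^ 2 := by
    rw [hsplit]
    calc (2 + i : ℝ) * l * (b * t ^ γ) ≤ (2 + r : ℝ) * l * (b * t ^ γ) := by gcongr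
      _ = ((2 + r : ℝ) * l * b) * t ^ γ := by ring
      _ ≤ (a / 2 * t ^ (2 - γ)) * t ^ γ :=
        mul_le_mul_of_nonneg_right (hr.trans (by gcongr)) htγ.le
      _ = _ := by ring
  linarith

/-- The Bernstein exponent of an initial segment of length `n ≥ 2^r`. -/
lemma anchor_exponent {a b c γ p : ℝ} (hb : 0 ≤ b) (hγ2 : γ < 2) (hc : 0 < c)
    (hp : 0 < p) {r n : ℕ} (hn : 2 ^ r ≤ n) (hl : 1 ≤ Real.log r)
    (hr : b * c ^ γ * (r * ((2 : ℝ) ^ (γ / 2 - 1)) ^ r) ≤ a * c ^ 2 / p - 1) :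
    p * Real.log r ≤ a * (c * √(n * Real.log r)) ^ 2 /
      ((n : ℝ) + b * (c * √(n * Real.log r)) ^ γ) := by
  set l := Real.log r
  have hlr : l ≤ r := Real.log_le_self (by positivity)
  have hn' : (2 : ℝ) ^ r ≤ n := by exact_mod_cast hn
  have hn0 : (0 : ℝ) < n := lt_of_lt_of_le (by positivity) hn'
  have hl0 : 0 < l := by linarith
  have htγ : (c * √(n * l)) ^ γ ≤ n * (c ^ γ * (r * ((2 : ℝ) ^ (γ / 2 - 1)) ^ r)) := by
    rw [Real.mul_rpow hc.le (by positivity), Real.sqrt_eq_rpow, ← Real.rpow_mul (by positivity),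
      Real.mul_rpow hn0.le hl0.le]
    have h1 : l ^ (1 / 2 * γ) ≤ r := by
      calc l ^ (1 / 2 * γ) ≤ l ^ (1 : ℝ) := Real.rpow_le_rpow_of_exponent_le hl (by linarith)
        _ ≤ r := by simpa using hlr
    have h2 : (n : ℝ) ^ (1 / 2 * γ) ≤ n * ((2 : ℝ) ^ (γ / 2 - 1)) ^ r := by
      have : (n : ℝ) ^ (1 / 2 * γ) = n * (n : ℝ) ^ (γ / 2 - 1) := by
        rw [Real.rpow_sub hn0, Real.rpow_one]; field_simp
      rw [this, ← Real.rpow_natCast, ← Real.rpow_mul (by norm_num), mul_comm (γ / 2 - 1),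
        Real.rpow_mul (by norm_num), Real.rpow_natCast]
      gcongr ?_ * ?_
      exact Real.rpow_le_rpow_of_nonpos (by positivity) hn' (by linarith)
    calc c ^ γ * ((n : ℝ) ^ (1 / 2 * γ) * l ^ (1 / 2 * γ))
        ≤ c ^ γ * ((n * ((2 : ℝ) ^ (γ / 2 - 1)) ^ r) * r) := by gcongr
      _ = _ := by ring
  rw [le_div_iff₀ (by positivity), mul_pow c, Real.sq_sqrt (by positivity)]
  have h3 : (n : ℝ) + b * (c * √(n * l)) ^ γ ≤ n * (a * c ^ 2 / p) := by
    calc (n : ℝ) + b * (c * √(n * l)) ^ γ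
        ≤ n + b * (n * (c ^ γ * (r * ((2 : ℝ) ^ (γ / 2 - 1)) ^ r))) := by gcongr
      _ = n + n * (b * c ^ γ * (r * ((2 : ℝ) ^ (γ / 2 - 1)) ^ r)) := by ring
      _ ≤ n + n * (a * c ^ 2 / p - 1) := by gcongr
      _ = _ := by ring
  calc p * l * (n + b * (c * √(n * l)) ^ γ) ≤ p * l * (n * (a * c ^ 2 / p)) := by gcongr
    _ = _ := by field_simp

/-- The union bound over the blocks of all levels `i ≤ r`, each of probability at most
`A * r ^ (-(2 + i))`. -/
lemma sum_block_bound {A : ℝ} (hA : 0 ≤ A) (L : ℕ) {r : ℕ} (hr : 4 ≤ r) :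
    ∑ i ∈ Finset.Ioc L r, (2 : ℝ) ^ i * (A * Real.exp (-((2 + i) * Real.log r)))
      ≤ 2 * A * (1 / (r : ℝ) ^ 2) := by
  have hr' : (4 : ℝ) ≤ r := by exact_mod_cast hr
  have hr0 : (0 : ℝ) < r := by linarith
  have hterm : ∀ i : ℕ, (2 : ℝ) ^ i * (A * Real.exp (-((2 + i) * Real.log r)))
      ≤ A * (1 / (r : ℝ) ^ 2) * (1 / 2) ^ i := by
    intro i
    have : Real.exp (-((2 + i) * Real.log r)) = 1 / (r : ℝ) ^ 2 * (1 / r) ^ i := by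
      rw [Real.exp_neg,
        show (2 + i : ℝ) * Real.log r = ((2 + i : ℕ) : ℝ) * Real.log r by push_cast; ring,
        Real.exp_nat_mul, Real.exp_log hr0, pow_add, one_div_pow]
      field_simp
    rw [this]
    calc (2 : ℝ) ^ i * (A * (1 / (r : ℝ) ^ 2 * (1 / r) ^ i))
        = A * (1 / (r : ℝ) ^ 2) * (2 / r) ^ i := by
          rw [div_pow, div_pow, one_pow]; ring
      _ ≤ _ := by
          have : 2 / (r : ℝ) ≤ 1 / 2 := by
            rw [div_le_div_iff₀ hr0 (by norm_num)]; linarith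
          gcongr ?_ * ?_ ^ i
  calc _ ≤ ∑ i ∈ Finset.Ioc L r, A * (1 / (r : ℝ) ^ 2) * (1 / 2) ^ i :=
        Finset.sum_le_sum fun i _ => hterm i
    _ = A * (1 / (r : ℝ) ^ 2) * ∑ i ∈ Finset.Ioc L r, (1 / 2) ^ i := by rw [Finset.mul_sum]
    _ ≤ A * (1 / (r : ℝ) ^ 2) * 2 := by
        gcongr
        exact (summable_geometric_two.sum_le_tsum _ fun i _ => by positivity).trans_eq
          tsum_geometric_two
    _ = _ := by ring

/-- First Borel–Cantelli lemma, with a summable bound that holds eventually. -/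
lemma ae_eventually_notMem_of_eventually_le {Ω : Type*} [MeasurableSpace Ω] {P : Measure Ω}
    {B : ℕ → Set Ω} {f : ℕ → ℝ} (hf0 : ∀ r, 0 ≤ f r) (hf : Summable f)
    (hB : ∀ᶠ r in atTop, P (B r) ≤ ENNReal.ofReal (f r)) :
    ∀ᵐ ω ∂P, ∀ᶠ r in atTop, ω ∉ B r := by
  obtain ⟨N, hN⟩ := eventually_atTop.1 hB
  have hsum : ∑' r, P (B (r + N)) ≠ ⊤ := by
    refine ne_top_of_le_ne_top ?_ (ENNReal.tsum_le_tsum fun r => hN (r + N) (by omega))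
    rw [← ENNReal.ofReal_tsum_of_nonneg (fun r => hf0 _) ((summable_nat_add_iff N).2 hf)]
    exact ENNReal.ofReal_ne_top
  filter_upwards [ae_eventually_notMem hsum] with ω hω
  obtain ⟨M, hM⟩ := eventually_atTop.1 hω
  refine eventually_atTop.2 ⟨M + N, fun r hr => ?_⟩
  have := hM (r - N) (by omega)
  rwa [Nat.sub_add_cancel (by omega)] at this

lemma sum_Icc_one_add_sub (x : ℕ → ℝ) (m n : ℕ) :
    ∑ i ∈ Finset.Icc 1 (m + n), x i - ∑ i ∈ Finset.Icc 1 m, x i =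
      ∑ i ∈ Finset.Icc (m + 1) (m + n), x i := by
  have h : ∀ k l : ℕ, Finset.Icc (k + 1) l = Finset.Ioc k l := fun k l => by
    ext; simp only [Finset.mem_Icc, Finset.mem_Ioc]; omega
  rw [sub_eq_iff_eq_add', ← zero_add 1, h, h, h]
  exact (Finset.sum_Ioc_consecutive x (Nat.zero_le m) (Nat.le_add_right m n)).symm

/-- The exceptional event at scale `r`: an increment over a dyadic block of level in `(L, r]`, or
a partial sum at a dyadic point of level `L`, is too large. -/
def exceptional {Ω : Type*} (X : ℕ → Ω → ℝ) (c : ℝ) (L r : ℕ) : Set Ω :=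
  (⋃ i ∈ Finset.Ioc L r, ⋃ p ∈ Finset.Ico (2 ^ i) (2 ^ (i + 1)),
    {ω | (3 / 4 : ℝ) ^ i * √(2 ^ r * Real.log r) <
      |∑ k ∈ Finset.Icc (p * 2 ^ (r - i) + 1) (p * 2 ^ (r - i) + 2 ^ (r - i)), X k ω|}) ∪
  ⋃ p ∈ Finset.Ico (2 ^ L) (2 ^ (L + 1)),
    {ω | c * √((p * 2 ^ (r - L) : ℕ) * Real.log r) <
      |∑ k ∈ Finset.Icc (0 + 1) (0 + p * 2 ^ (r - L)), X k ω|}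

/-- Outside the exceptional event, the partial sums are controlled at scale `r`. -/
lemma abs_sum_le_of_notMem_exceptional {Ω : Type*} {X : ℕ → Ω → ℝ} {c : ℝ} (hc : 0 ≤ c)
    {L r n : ℕ} {ω : Ω} (hω : ω ∉ exceptional X c L r) (hLr : L ≤ r) (hn : 2 ^ r ≤ n)
    (hn' : n < 2 ^ (r + 1)) :
    |∑ k ∈ Finset.Icc 1 n, X k ω| ≤ (c + 3 * (3 / 4) ^ L) * √(n * Real.log r) := by
  simp only [exceptional, Set.mem_union, Set.mem_iUnion, Set.mem_ofPred_eq, not_or, not_exists,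
    not_lt, zero_add] at hω
  obtain ⟨hblock, hanchor⟩ := hω
  have hpow : 2 ^ r = 2 ^ L * 2 ^ (r - L) := by rw [← pow_add]; congr 1; omega
  have hmem : n / 2 ^ (r - L) ∈ Finset.Ico (2 ^ L) (2 ^ (L + 1)) := by
    rw [Finset.mem_Ico, Nat.le_div_iff_mul_le (by positivity),
      Nat.div_lt_iff_lt_mul (by positivity)]
    refine ⟨hpow ▸ hn, hn'.trans_eq ?_⟩
    rw [pow_succ, hpow, pow_succ]; ring
  have h := abs_le_of_dyadic_increments (fun n => ∑ k ∈ Finset.Icc 1 n, X k ω)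
    (Real.sqrt_nonneg (2 ^ r * Real.log r)) hLr hn hn' (hanchor _ hmem) (by
      intro i hi hir p hp
      rw [sum_Icc_one_add_sub]
      exact hblock i (Finset.mem_Ioc.2 ⟨hi, hir⟩) p hp)
  have h1 : √((n / 2 ^ (r - L) * 2 ^ (r - L) : ℕ) * Real.log r) ≤ √(n * Real.log r) := by
    gcongr; exact Nat.div_mul_le_self _ _
  have h2 : √(2 ^ r * Real.log r) ≤ √(n * Real.log r) := by
    gcongr; exact_mod_cast hn
  calc _ ≤ _ := h
    _ ≤ c * √(n * Real.log r) + 3 * (3 / 4) ^ L * √(n * Real.log r) := by gcongr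
    _ = _ := by ring

/-- Union bound for the exceptional event, given lower bounds for the Bernstein exponents. -/
lemma measure_exceptional_le {Ω : Type*} [MeasurableSpace Ω] {P : Measure Ω} {X : ℕ → Ω → ℝ}
    {A a b γ c p : ℝ} (hA : 0 ≤ A) (hc : 0 ≤ c)
    (hBern : ∀ (m n : ℕ), 1 ≤ n → ∀ t : ℝ, 0 ≤ t →
      P {ω | t < |∑ i ∈ Finset.Icc (m + 1) (m + n), X i ω|}
        ≤ ENNReal.ofReal (A * Real.exp (-(a * t ^ 2) / (n + b * t ^ γ))))
    {L r : ℕ} (hLr : L ≤ r) (hr : 4 ≤ r)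
    (hblock : ∀ i, L < i → i ≤ r →
      (2 + i : ℝ) * Real.log r ≤ a * ((3 / 4) ^ i * √(2 ^ r * Real.log r)) ^ 2 /
        (((2 ^ (r - i) : ℕ) : ℝ) + b * ((3 / 4) ^ i * √(2 ^ r * Real.log r)) ^ γ))
    (hanchor : ∀ n : ℕ, 2 ^ r ≤ n →
      p * Real.log r ≤ a * (c * √(n * Real.log r)) ^ 2 /
        ((n : ℝ) + b * (c * √(n * Real.log r)) ^ γ)) :
    P (exceptional X c L r) ≤
      ENNReal.ofReal (2 * A * (1 / (r : ℝ) ^ 2) + 2 ^ L * A * (1 / (r : ℝ) ^ p)) := by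
  have hr0 : (0 : ℝ) < r := by exact_mod_cast (by omega : 0 < r)
  rw [ENNReal.ofReal_add (by positivity) (by positivity)]
  refine (measure_union_le _ _).trans (add_le_add ?_ ?_)
  · refine le_trans ?_ (ENNReal.ofReal_le_ofReal (sum_block_bound hA L hr))
    rw [ENNReal.ofReal_sum_of_nonneg fun i _ => by positivity]
    refine (measure_biUnion_finset_le _ _).trans (Finset.sum_le_sum fun i hi => ?_)
    rw [Finset.mem_Ioc] at hi
    refine (measure_biUnion_finset_le _ _).trans
      ((Finset.sum_le_card_nsmul _ _ (ENNReal.ofReal (A * Real.exp (-((2 + i) * Real.log r))))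
        fun q _ => ?_).trans_eq ?_)
    · refine (hBern _ _ Nat.one_le_two_pow _ (by positivity)).trans ?_
      gcongr
      rw [neg_div]
      exact neg_le_neg (hblock i hi.1 hi.2)
    · rw [Nat.card_Ico, show 2 ^ (i + 1) - 2 ^ i = 2 ^ i by rw [pow_succ]; omega, nsmul_eq_mul,
        ENNReal.ofReal_mul (p := 2 ^ i) (by positivity)]
      simp [ENNReal.ofReal_pow]
  · refine (measure_biUnion_finset_le _ _).trans
      ((Finset.sum_le_card_nsmul _ _ (ENNReal.ofReal (A * (1 / (r : ℝ) ^ p)))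
        fun q hq => ?_).trans_eq ?_)
    · have hq' : 2 ^ r ≤ q * 2 ^ (r - L) := by
        calc 2 ^ r = 2 ^ L * 2 ^ (r - L) := by rw [← pow_add]; congr 1; omega
          _ ≤ _ := Nat.mul_le_mul_right _ (Finset.mem_Ico.1 hq).1
      refine (hBern _ _ (Nat.one_le_two_pow.trans hq') _ (by positivity)).trans ?_
      have he : 1 / (r : ℝ) ^ p = Real.exp (-(p * Real.log r)) := by
        rw [Real.exp_neg, Real.rpow_def_of_pos hr0, one_div, mul_comm]
      rw [he]
      gcongr
      rw [neg_div]
      exact neg_le_neg (hanchor _ hq')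
    · rw [Nat.card_Ico, show 2 ^ (L + 1) - 2 ^ L = 2 ^ L by rw [pow_succ]; omega, nsmul_eq_mul,
        mul_assoc, ENNReal.ofReal_mul (p := 2 ^ L) (by positivity)]
      simp [ENNReal.ofReal_pow]

lemma eventually_log_pow_bound {a b γ : ℝ} (ha : 0 < a) (hγ2 : γ < 2) :
    ∀ᶠ r : ℕ in atTop, (2 + r : ℝ) * Real.log r * b ≤ a / 2 * ((9 / 8 : ℝ) ^ (1 - γ / 2)) ^ r := by
  set η := (9 / 8 : ℝ) ^ (1 - γ / 2)
  have hη : 1 < η := Real.one_lt_rpow (by norm_num) (by linarith)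
  have ht : Tendsto (fun r : ℕ => 3 * |b| * ((r : ℝ) ^ 2 / η ^ r)) atTop (nhds 0) := by
    simpa using (tendsto_pow_const_div_const_pow_of_one_lt 2 hη).const_mul (3 * |b|)
  filter_upwards [ht.eventually_le_const (half_pos ha), eventually_ge_atTop 1] with r hr hr1
  have hr1' : (1 : ℝ) ≤ r := by exact_mod_cast hr1
  have hηr : 0 < η ^ r := by positivity
  have hlog0 := Real.log_nonneg hr1'
  have hlog : Real.log r ≤ r := Real.log_le_self (by positivity)
  calc (2 + r : ℝ) * Real.log r * b ≤ (2 + r) * Real.log r * |b| := by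
        gcongr; exact le_abs_self b
    _ ≤ (2 * r + r) * r * |b| := by gcongr; linarith
    _ = 3 * |b| * (r ^ 2 / η ^ r) * η ^ r := by field_simp; ring
    _ ≤ _ := by gcongr

/-- For every `C > 1 / √a`, almost surely `|S(1,n)| ≤ C √(n log log n)` eventually. -/
lemma ae_eventually_abs_sum_le
    {Ω : Type*} [MeasurableSpace Ω] (P : Measure Ω)
    (X : ℕ → Ω → ℝ) (A a b γ : ℝ)
    (hA : 0 < A) (ha : 0 < a) (hb : 0 ≤ b) (hγ2 : γ < 2)
    (hBern : ∀ (m n : ℕ), 1 ≤ n → ∀ t : ℝ, 0 ≤ t →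
      P {ω | t < |∑ i ∈ Finset.Icc (m + 1) (m + n), X i ω|}
        ≤ ENNReal.ofReal (A * Real.exp (-(a * t ^ 2) / (n + b * t ^ γ))))
    {C : ℝ} (hC : 1 / √a < C) :
    ∀ᵐ ω ∂P, ∀ᶠ n : ℕ in atTop,
      |∑ i ∈ Finset.Icc 1 n, X i ω| ≤ C * √(n * Real.log (Real.log n)) := by
  obtain ⟨c', hc'1, hc'C⟩ := exists_between hC
  obtain ⟨c, hc1, hcc'⟩ := exists_between hc'1
  have hc0 : 0 < c := lt_trans (by positivity) hc1
  have hc'0 : 0 < c' := hc0.trans hcc'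
  have hac : 1 < a * c ^ 2 := by
    have h1 : 1 < c * √a := by rwa [div_lt_iff₀ (by positivity)] at hc1
    calc (1 : ℝ) < (c * √a) ^ 2 := one_lt_pow₀ h1 (by norm_num)
      _ = a * c ^ 2 := by rw [mul_pow, Real.sq_sqrt ha.le]; ring
  obtain ⟨p, hp1, hpac⟩ := exists_between hac
  have hp0 : 0 < p := by linarith
  have hκ : 0 < a * c ^ 2 / p - 1 := by
    rw [sub_pos, lt_div_iff₀ hp0]; linarith
  obtain ⟨L, hL⟩ : ∃ L : ℕ, 3 * (3 / 4 : ℝ) ^ L ≤ c' - c ∧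
      ∀ i, L ≤ i → (2 + i : ℝ) ≤ a / 2 * (9 / 8) ^ i := by
    have h1 : Tendsto (fun L : ℕ => 3 * (3 / 4 : ℝ) ^ L) atTop (nhds 0) := by
      simpa using (tendsto_pow_atTop_nhds_zero_of_lt_one (r := (3 / 4 : ℝ)) (by norm_num)
        (by norm_num)).const_mul 3
    have h2 : Tendsto (fun i : ℕ => 3 * ((i : ℝ) ^ 1 / (9 / 8) ^ i)) atTop (nhds 0) := by
      simpa using (tendsto_pow_const_div_const_pow_of_one_lt 1
        (show (1 : ℝ) < 9 / 8 by norm_num)).const_mul 3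
    have h3 : ∀ᶠ i : ℕ in atTop, (2 + i : ℝ) ≤ a / 2 * (9 / 8) ^ i := by
      filter_upwards [h2.eventually_le_const (half_pos ha), eventually_ge_atTop 1] with i hi hi1
      have hi1' : (1 : ℝ) ≤ i := by exact_mod_cast hi1
      calc (2 + i : ℝ) ≤ 3 * i := by linarith
        _ = 3 * ((i : ℝ) ^ 1 / (9 / 8) ^ i) * (9 / 8) ^ i := by field_simp
        _ ≤ _ := by gcongr
    exact ((h1.eventually_le_const (sub_pos.2 hcc')).and (eventually_forall_ge_atTop.2 h3)).exists
  obtain ⟨hLc, hLi⟩ := hL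
  have hlog : Tendsto (fun r : ℕ => Real.log r) atTop atTop :=
    Real.tendsto_log_atTop.comp tendsto_natCast_atTop_atTop
  have hgeom : Tendsto (fun r : ℕ => b * c ^ γ * (r * ((2 : ℝ) ^ (γ / 2 - 1)) ^ r)) atTop
      (nhds 0) := by
    simpa using (tendsto_self_mul_const_pow_of_lt_one (r := (2 : ℝ) ^ (γ / 2 - 1)) (by positivity)
      (Real.rpow_lt_one_of_one_lt_of_neg (by norm_num) (by linarith))).const_mul (b * c ^ γ)
  have hsum : Summable fun r : ℕ =>
      2 * A * (1 / (r : ℝ) ^ 2) + 2 ^ L * A * (1 / (r : ℝ) ^ p) :=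
    ((Real.summable_one_div_nat_pow.2 (by norm_num)).mul_left _).add
      ((Real.summable_one_div_nat_rpow.2 hp1).mul_left _)
  have hprob : ∀ᶠ r : ℕ in atTop, P (exceptional X c L r) ≤
      ENNReal.ofReal (2 * A * (1 / (r : ℝ) ^ 2) + 2 ^ L * A * (1 / (r : ℝ) ^ p)) := by
    filter_upwards [eventually_ge_atTop L, eventually_ge_atTop 4, hlog.eventually_ge_atTop 1,
      eventually_log_pow_bound (b := b) ha hγ2, hgeom.eventually_le_const hκ]
      with r hrL hr4 hl hr1 hr2
    exact measure_exceptional_le hA.le hc0.le hBern hrL hr4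
      (fun i hi hir => block_exponent hb hγ2 ha rfl hir hl (hLi i hi.le) hr1)
      (fun n hn => anchor_exponent hb hγ2 hc0 hp0 hn hl hr2)
  have hloglog : ∀ᶠ r : ℕ in atTop,
      c' ^ 2 * Real.log r ≤ C ^ 2 * (Real.log r + Real.log (Real.log 2)) := by
    have hpos : 0 < C ^ 2 - c' ^ 2 := by nlinarith
    filter_upwards [hlog.eventually_ge_atTop (-(C ^ 2 * Real.log (Real.log 2)) / (C ^ 2 - c' ^ 2))]
      with r hr
    rw [div_le_iff₀ hpos] at hr
    linarith
  filter_upwards [ae_eventually_notMem_of_eventually_le (fun r => by positivity) hsum hprob]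
    with ω hω
  have hNat : Tendsto (fun n : ℕ => Nat.log 2 n) atTop atTop :=
    tendsto_atTop_atTop.2 fun k => ⟨2 ^ k, fun n hn => Nat.le_log_of_pow_le (by norm_num) hn⟩
  filter_upwards [hNat.eventually (hω.and (hloglog.and ((eventually_ge_atTop L).and
    (hlog.eventually_ge_atTop 1)))), eventually_ge_atTop 1] with n ⟨hnω, hnl, hnL, hn1⟩ hn0
  set r := Nat.log 2 n
  have hlow : 2 ^ r ≤ n := Nat.pow_log_le_self 2 (by omega)
  have hup : n < 2 ^ (r + 1) := Nat.lt_pow_succ_log_self (by norm_num) n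
  have h := abs_sum_le_of_notMem_exceptional hc0.le hnω hnL hlow hup
  have hr0 : (0 : ℝ) < r := by
    rcases Nat.eq_zero_or_pos r with h0 | h0
    · rw [h0] at hn1; norm_num at hn1
    · exact_mod_cast h0
  have hlog2 : 0 < Real.log 2 := Real.log_pos (by norm_num)
  have hLL : Real.log r + Real.log (Real.log 2) ≤ Real.log (Real.log n) := by
    rw [← Real.log_mul hr0.ne' hlog2.ne']
    refine Real.log_le_log (by positivity) ?_
    rw [← Real.log_pow]
    exact Real.log_le_log (by positivity) (by exact_mod_cast hlow)
  have hC0 : 0 ≤ C := by linarith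
  calc _ ≤ _ := h
    _ ≤ c' * √(n * Real.log r) := by gcongr; linarith
    _ = √(n * (c' ^ 2 * Real.log r)) := by
        rw [show (n : ℝ) * (c' ^ 2 * Real.log r) = c' ^ 2 * (n * Real.log r) by ring,
          Real.sqrt_mul (sq_nonneg c'), Real.sqrt_sq hc'0.le]
    _ ≤ √(n * (C ^ 2 * Real.log (Real.log n))) := by
        refine Real.sqrt_le_sqrt ?_
        exact mul_le_mul_of_nonneg_left
          (hnl.trans (mul_le_mul_of_nonneg_left hLL (sq_nonneg C))) (by positivity)
    _ = C * √(n * Real.log (Real.log n)) := by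
        rw [show (n : ℝ) * (C ^ 2 * Real.log (Real.log n)) = C ^ 2 * (n * Real.log (Real.log n))
          by ring, Real.sqrt_mul (sq_nonneg C), Real.sqrt_sq hC0]

end BoundedLIL

/-- **Bounded law of the iterated logarithm** (Kevei–Mason, Corollary 1).
If the partial sums `S(m+1, m+n) = ∑_{i=m+1}^{m+n} X i` of a sequence of real random
variables satisfy a generalized Bernstein-type inequality
`P{|S(m+1, m+n)| > t} ≤ A · exp(−a t² / (n + b t^γ))`,
then with probability 1,
`limsup_{n→∞} |S(1,n)| / √(n · log log n) ≤ 1/√a`. -/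
theorem bounded_LIL
    {Ω : Type*} [MeasurableSpace Ω] (P : Measure Ω) [IsProbabilityMeasure P]
    (X : ℕ → Ω → ℝ) (A a b γ : ℝ)
    (hA : 0 < A) (ha : 0 < a) (hb : 0 ≤ b) (hγ : γ ∈ Set.Ioo (0 : ℝ) 2)
    (hBern : ∀ (m n : ℕ), 1 ≤ n → ∀ t : ℝ, 0 ≤ t →
      P {ω | t < |∑ i ∈ Finset.Icc (m + 1) (m + n), X i ω|}
        ≤ ENNReal.ofReal (A * Real.exp (-(a * t ^ 2) / (n + b * t ^ γ)))) :
    ∀ᵐ ω ∂P,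
      Filter.limsup
          (fun n : ℕ =>
            ((|∑ i ∈ Finset.Icc 1 n, X i ω| /
                Real.sqrt (n * Real.log (Real.log n)) : ℝ) : EReal))
          Filter.atTop
        ≤ ((1 / Real.sqrt a : ℝ) : EReal) := by
  have hall : ∀ᵐ ω ∂P, ∀ k : ℕ, ∀ᶠ n : ℕ in atTop, |∑ i ∈ Finset.Icc 1 n, X i ω| ≤
      (1 / √a + 1 / ((k : ℝ) + 1)) * √(n * Real.log (Real.log n)) :=
    ae_all_iff.2 fun k => BoundedLIL.ae_eventually_abs_sum_le P X A a b γ hA ha hb hγ.2 hBern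
      (lt_add_of_pos_right _ (by positivity))
  filter_upwards [hall] with ω hω
  have hlim : Tendsto (fun k : ℕ => ((1 / √a + 1 / ((k : ℝ) + 1) : ℝ) : EReal)) atTop
      (nhds ((1 / √a : ℝ) : EReal)) := by
    refine (continuous_coe_real_ereal.tendsto _).comp ?_
    simpa using (tendsto_one_div_add_atTop_nhds_zero_nat (𝕜 := ℝ)).const_add (1 / √a)
  refine ge_of_tendsto' hlim fun k => ?_
  refine Filter.limsup_le_of_le (h := ?_)
  filter_upwards [hω k] with n hn
  exact EReal.coe_le_coe_iff.2 (div_le_of_le_mul₀ (Real.sqrt_nonneg _) (by positivity) hn)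
end

section
/- Let X_1, X_2, … be a sequence of real-valued random variables and let C > 0, v > 0, M > 0 be constants such that for all integers m ≥ 0, n ≥ 1 and all reals t ≥ 0, P{|S(m+1, m+n)| > t} ≤ exp(−C t² / (n v² + M² + t M (log n)²)). Then for every η ∈ (0,1) and every γ = 1 + η there exist constants C' > 0, c > 0 and b ≥ 0 such that for all integers m ≥ 0, n ≥ 1 and all reals t ≥ 0, P{M(m+1, m+n) > t} ≤ C'·exp(−c t² / (n + b t^γ)). -/
open MeasureTheory Finset

/-- A stretched exponential beats every power. -/
lemma exists_pow_mul_exp_neg_rpow_le (p : ℕ) {c α : ℝ} (hc : 0 < c) (hα : 0 < α) :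
    ∃ D : ℝ, 0 < D ∧ ∀ y : ℝ, 1 ≤ y → y ^ p * Real.exp (-(c * y ^ α)) ≤ D := by
  obtain ⟨N, hN⟩ := exists_nat_ge ((p : ℝ) / α)
  refine ⟨N.factorial / c ^ N, by positivity, fun y hy => ?_⟩
  have hy0 : 0 < y := by linarith
  have hexp := Real.pow_div_factorial_le_exp (c * y ^ α) (by positivity) N
  have hpow : y ^ p ≤ (y ^ α) ^ N := by
    rw [← Real.rpow_natCast, ← Real.rpow_natCast, ← Real.rpow_mul hy0.le]
    refine Real.rpow_le_rpow_of_exponent_le hy ?_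
    rw [div_le_iff₀ hα] at hN
    linarith
  rw [Real.exp_neg, ← div_eq_mul_inv, div_le_div_iff₀ (Real.exp_pos _) (by positivity)]
  rw [div_le_iff₀ (by positivity), mul_pow] at hexp
  calc y ^ p * c ^ N ≤ c ^ N * (y ^ α) ^ N := by
        rw [mul_comm]; gcongr
    _ ≤ _ := by linarith

/-- Dyadic chaining: the increments over dyadic blocks control the distance from `T j` to its
value at the largest multiple of `2 ^ k` below `j`. -/
lemma abs_sub_le_sum_of_dyadic_increments (T u : ℕ → ℝ) (n : ℕ) (hu : ∀ k, 0 ≤ u k)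
    (h : ∀ k a, (a + 1) * 2 ^ k ≤ n → |T (a * 2 ^ k + 2 ^ k) - T (a * 2 ^ k)| ≤ u k)
    {j : ℕ} (hj : j ≤ n) (k : ℕ) :
    |T j - T (j / 2 ^ k * 2 ^ k)| ≤ ∑ i ∈ range k, u i := by
  induction k with
  | zero => simp
  | succ k ih =>
    rw [sum_range_succ]
    have hdiv : j / 2 ^ (k + 1) = j / 2 ^ k / 2 := by rw [pow_succ, Nat.div_div_eq_div_mul]
    have hle : j / 2 ^ k * 2 ^ k ≤ n := (Nat.div_mul_le_self _ _).trans hj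
    rw [hdiv]
    generalize j / 2 ^ k = q at *
    rcases Nat.even_or_odd' q with ⟨a, rfl | rfl⟩
    · have : 2 * a / 2 * 2 ^ (k + 1) = 2 * a * 2 ^ k := by
        rw [Nat.mul_div_cancel_left _ two_pos]; ring
      rw [this]
      linarith [hu k]
    · have : (2 * a + 1) / 2 * 2 ^ (k + 1) = 2 * a * 2 ^ k := by
        rw [show (2 * a + 1) / 2 = a by omega]; ring
      rw [this]
      have hb := h k (2 * a) hle
      rw [show 2 * a * 2 ^ k + 2 ^ k = (2 * a + 1) * 2 ^ k by ring] at hb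
      linarith [abs_sub_le (T j) (T ((2 * a + 1) * 2 ^ k)) (T (2 * a * 2 ^ k))]

/-- The contribution of one dyadic level, of block length `ℓ ≈ n / y`, to the union bound. -/
lemma exists_level_bound {C v M w η : ℝ} (hC : 0 < C) (hv : 0 < v) (hM : 0 < M) (hw : 0 < w)
    (hη : η ∈ Set.Ioo (0 : ℝ) 1) :
    ∃ D c : ℝ, 0 < D ∧ 0 < c ∧ ∀ n t y ℓ : ℝ, 1 ≤ y → 1 ≤ ℓ → 0 ≤ t → n ≤ t ^ 2 →
      ℓ * y ≤ n → n ≤ 2 * (ℓ * y) →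
      n / ℓ * Real.exp (-(C * (t * w * y ^ (-(η / 6))) ^ 2) /
        (ℓ * v ^ 2 + M ^ 2 + t * w * y ^ (-(η / 6)) * M * Real.log ℓ ^ 2))
      ≤ D * y⁻¹ * Real.exp (-(c * t ^ 2) / (n + t ^ (1 + η))) := by
  obtain ⟨hη0, hη1⟩ := hη
  set δ := η / 6 with hδ
  have hδ0 : 0 < δ := by positivity
  set A := v ^ 2 + M ^ 2 with hA
  have hA0 : 0 < A := by positivity
  set c₁ := C * w ^ 2 / (2 * A) with hc₁
  set c₂ := C * w * δ ^ 2 / (2 * M) with hc₂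
  have hc₁0 : 0 < c₁ := by positivity
  have hc₂0 : 0 < c₂ := by positivity
  obtain ⟨D₁, hD₁, hquad⟩ := exists_pow_mul_exp_neg_rpow_le 2 (half_pos hc₁0)
    (show 0 < 1 - 2 * δ by linarith)
  obtain ⟨D₂, hD₂, hlin⟩ := exists_pow_mul_exp_neg_rpow_le 4 (half_pos hc₂0)
    (show 0 < 1 - 6 * δ by linarith)
  refine ⟨2 * (D₁ + D₂), min (c₁ / 2) (c₂ / 2), by positivity, by positivity, ?_⟩
  intro n t y ℓ hy hℓ ht hnt hlow hup
  have hy0 : 0 < y := by linarith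
  have hℓ0 : 0 < ℓ := by linarith
  have hyn : y ≤ n := by nlinarith
  have hℓn : ℓ ≤ n := by nlinarith
  have hn0 : 0 < n := by linarith
  have ht1 : 1 ≤ t := by nlinarith
  have ht0 : 0 < t := by linarith
  set c := min (c₁ / 2) (c₂ / 2) with hc
  have hc0 : 0 < c := by positivity
  set τ := t * w * y ^ (-δ) with hτ
  have hτ0 : 0 < τ := by positivity
  have hcount : n / ℓ ≤ 2 * y := by
    rw [div_le_iff₀ hℓ0]; linarith
  have hden : ℓ * v ^ 2 + M ^ 2 ≤ ℓ * A := by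
    rw [hA]; nlinarith [sq_nonneg M]
  have hs0 : 0 < t ^ (1 + η) := by positivity
  -- It suffices to split the exponent into a summable part and the target part.
  have key : ∀ E F D₀ : ℝ, D₀ ≤ D₁ + D₂ →
      F + c * t ^ 2 / (n + t ^ (1 + η)) ≤ E → y ^ 2 * Real.exp (-F) ≤ D₀ →
      n / ℓ * Real.exp (-E) ≤
        2 * (D₁ + D₂) * y⁻¹ * Real.exp (-(c * t ^ 2) / (n + t ^ (1 + η))) := by
    intro E F D₀ hD₀ hE hF
    have h1 : Real.exp (-E) ≤
        Real.exp (-F) * Real.exp (-(c * t ^ 2) / (n + t ^ (1 + η))) := by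
      rw [← Real.exp_add]
      apply Real.exp_le_exp.2
      rw [neg_div]; linarith
    calc n / ℓ * Real.exp (-E)
        ≤ 2 * y * (Real.exp (-F) * Real.exp (-(c * t ^ 2) / (n + t ^ (1 + η)))) := by gcongr
      _ = 2 * (y ^ 2 * Real.exp (-F)) * y⁻¹
            * Real.exp (-(c * t ^ 2) / (n + t ^ (1 + η))) := by
          field_simp
      _ ≤ _ := by gcongr; exact hF.trans hD₀
  rw [neg_div]
  rcases le_or_gt (τ * M * Real.log ℓ ^ 2) (ℓ * A) with hcase | hcase
  · have hx : 1 ≤ t ^ 2 / n := by rw [le_div_iff₀ hn0]; linarith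
    have hz : 1 ≤ y ^ (1 - 2 * δ) := Real.one_le_rpow hy (by linarith)
    refine key _ (c₁ / 2 * y ^ (1 - 2 * δ)) D₁ (by linarith) ?_ (hquad y hy)
    have htarget : c * t ^ 2 / (n + t ^ (1 + η)) ≤ c₁ / 2 * (t ^ 2 / n) := by
      rw [← mul_div_assoc]
      gcongr
      · exact min_le_left _ _
      · linarith
    have hprod : y ^ (1 - 2 * δ) + t ^ 2 / n ≤ 2 * (t ^ 2 / n * y ^ (1 - 2 * δ)) := by
      nlinarith [mul_nonneg (sub_nonneg.2 hx) (sub_nonneg.2 hz)]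
    have hyz : y ^ (1 - 2 * δ) = y * (y ^ (-δ)) ^ 2 := by
      rw [← Real.rpow_natCast (y ^ (-δ)) 2, ← Real.rpow_mul hy0.le]
      nth_rewrite 2 [← Real.rpow_one y]
      rw [← Real.rpow_add hy0]
      congr 1; push_cast; ring
    have hexp : c₁ * (t ^ 2 / n * y ^ (1 - 2 * δ)) ≤ C * τ ^ 2 / (2 * (ℓ * A)) := by
      have : C * τ ^ 2 / (2 * (ℓ * A)) = c₁ * (t ^ 2 * (y ^ (-δ)) ^ 2) * (1 / ℓ) := by
        rw [hτ, hc₁]; field_simp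
      rw [this, hyz]
      have h2 : y / n ≤ 1 / ℓ := by
        rw [div_le_div_iff₀ hn0 hℓ0]; linarith
      calc c₁ * (t ^ 2 / n * (y * (y ^ (-δ)) ^ 2))
          = c₁ * (t ^ 2 * (y ^ (-δ)) ^ 2) * (y / n) := by ring
        _ ≤ _ := by gcongr
    have hfin : C * τ ^ 2 / (2 * (ℓ * A)) ≤
        C * τ ^ 2 / (ℓ * v ^ 2 + M ^ 2 + τ * M * Real.log ℓ ^ 2) := by
      gcongr; linarith
    linarith [mul_le_mul_of_nonneg_left hprod (half_pos hc₁0).le]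
  · refine key _ (c₂ / 2 * t ^ (1 - 6 * δ)) D₂ (by linarith) ?_ ?_
    · have htarget : c * t ^ 2 / (n + t ^ (1 + η)) ≤ c₂ / 2 * t ^ (1 - 6 * δ) := by
        rw [div_le_iff₀ (by positivity)]
        have h2 : t ^ 2 = t ^ (1 - 6 * δ) * t ^ (1 + η) := by
          rw [← Real.rpow_add ht0, ← Real.rpow_natCast]
          congr 1; rw [hδ]; push_cast; ring
        calc c * t ^ 2 ≤ c₂ / 2 * t ^ 2 := by gcongr; exact min_le_right _ _
          _ = c₂ / 2 * t ^ (1 - 6 * δ) * t ^ (1 + η) := by rw [h2]; ring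
          _ ≤ _ := by gcongr; linarith
      have hsq : ∀ β : ℝ, (t ^ 2) ^ β = t ^ (2 * β) := fun β => by
        rw [Real.rpow_mul ht0.le, Real.rpow_two]
      have hlog : Real.log ℓ ≤ t ^ (2 * δ) / δ := by
        refine (Real.log_le_rpow_div hℓ0.le hδ0).trans ?_
        rw [← hsq]
        gcongr
        linarith
      have hτ_low : t * w * t ^ (-(2 * δ)) ≤ τ := by
        rw [hτ, show -(2 * δ) = 2 * (-δ) by ring, ← hsq]
        gcongr ?_ * ?_
        exact Real.rpow_le_rpow_of_nonpos hy0 (by linarith) (by linarith)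
      have hlog2 : Real.log ℓ ^ 2 ≤ (t ^ (2 * δ) / δ) ^ 2 := by
        have := Real.log_nonneg hℓ
        gcongr
      have hexp : c₂ * t ^ (1 - 6 * δ) * (2 * M * Real.log ℓ ^ 2) ≤ C * τ := by
        calc c₂ * t ^ (1 - 6 * δ) * (2 * M * Real.log ℓ ^ 2)
            ≤ c₂ * t ^ (1 - 6 * δ) * (2 * M * (t ^ (2 * δ) / δ) ^ 2) := by gcongr
          _ = C * w * (t ^ (1 - 6 * δ) * (t ^ (2 * δ) * t ^ (2 * δ))) := by
              rw [hc₂]; field_simp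
          _ = C * (t * w * t ^ (-(2 * δ))) := by
              rw [← Real.rpow_add ht0, ← Real.rpow_add ht0,
                show 1 - 6 * δ + (2 * δ + 2 * δ) = 1 + -(2 * δ) by ring,
                Real.rpow_add ht0, Real.rpow_one]
              ring
          _ ≤ _ := by gcongr
      have hfin : c₂ * t ^ (1 - 6 * δ) ≤
          C * τ ^ 2 / (ℓ * v ^ 2 + M ^ 2 + τ * M * Real.log ℓ ^ 2) := by
        rw [le_div_iff₀ (by positivity)]
        calc c₂ * t ^ (1 - 6 * δ) * (ℓ * v ^ 2 + M ^ 2 + τ * M * Real.log ℓ ^ 2)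
            ≤ c₂ * t ^ (1 - 6 * δ) * (2 * (τ * M * Real.log ℓ ^ 2)) := by gcongr; linarith
          _ = c₂ * t ^ (1 - 6 * δ) * (2 * M * Real.log ℓ ^ 2) * τ := by ring
          _ ≤ C * τ * τ := by gcongr
          _ = _ := by ring
      linarith
    · refine le_trans ?_ (hlin t ht1)
      gcongr
      calc y ^ 2 ≤ (t ^ 2) ^ 2 := by gcongr; linarith
        _ = t ^ 4 := by ring

/-- Union bound over the dyadic blocks contained in `(m, m + n]`. -/
lemma measure_lt_sup'_le_sum_dyadic {Ω : Type*} [MeasurableSpace Ω] (P : Measure Ω)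
    (X : ℕ → Ω → ℝ) (u : ℕ → ℝ) (hu : ∀ k, 0 ≤ u k) (m n K : ℕ)
    (hne : (Icc (m + 1) (m + n)).Nonempty) (hK : n < 2 ^ (K + 1)) (t : ℝ)
    (ht : ∑ k ∈ range (K + 1), u k ≤ t) :
    P {ω | t < (Icc (m + 1) (m + n)).sup' hne (fun j => |∑ i ∈ Icc (m + 1) j, X i ω|)}
      ≤ ∑ k ∈ range (K + 1), ∑ a ∈ range (n / 2 ^ k),
          P {ω | u k < |∑ i ∈ Icc (m + a * 2 ^ k + 1) (m + a * 2 ^ k + 2 ^ k), X i ω|} := by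
  refine le_trans (measure_mono ?_) ((measure_biUnion_finset_le (range (K + 1)) (fun k =>
    ⋃ a ∈ range (n / 2 ^ k),
      {ω | u k < |∑ i ∈ Icc (m + a * 2 ^ k + 1) (m + a * 2 ^ k + 2 ^ k), X i ω|})).trans
    (sum_le_sum fun k _ => measure_biUnion_finset_le _ _))
  intro ω hω
  by_contra hcon
  simp only [Set.mem_iUnion, Set.mem_ofPred_eq, mem_range, not_exists, not_lt,
    exists_prop, not_and] at hcon
  refine (not_lt.2 ?_) (Set.mem_ofPred_eq ▸ hω)
  refine sup'_le _ _ fun j hj => ?_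
  rw [mem_Icc] at hj
  obtain ⟨j, rfl⟩ := Nat.exists_eq_add_of_le (show m ≤ j by omega)
  have hjn : j ≤ n := by omega
  have hinc : ∀ p q : ℕ, ∑ i ∈ Icc (m + 1) (m + (p + q)), X i ω - ∑ i ∈ Icc (m + 1) (m + p), X i ω
      = ∑ i ∈ Icc (m + p + 1) (m + p + q), X i ω := by
    intro p q
    have hIoc : ∀ a b : ℕ, Icc (a + 1) b = Ioc a b := fun a b => by ext; simp
    rw [hIoc, hIoc, hIoc, sub_eq_iff_eq_add', ← add_assoc]
    exact (sum_Ioc_consecutive (fun i => X i ω) (by omega) (by omega)).symm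
  have hchain := abs_sub_le_sum_of_dyadic_increments
    (fun j => ∑ i ∈ Icc (m + 1) (m + j), X i ω) u n hu ?_ hjn (K + 1)
  · rw [Nat.div_eq_of_lt (hjn.trans_lt hK)] at hchain
    simpa using hchain.trans ht
  · intro k a hka
    simp only [hinc]
    have hpos : 0 < 2 ^ k := by positivity
    refine hcon k ?_ a ?_
    · by_contra hk
      have : 2 ^ (K + 1) ≤ 2 ^ k := Nat.pow_le_pow_right two_pos (by omega)
      nlinarith
    · exact (Nat.le_div_iff_mul_le hpos).2 hka

/-- Combination of Example 3 and Theorem 1 of Kevei–Mason: if a sequence of real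
random variables satisfies the Merlevède–Peligrad–Rio type inequality
`P{|S(m+1, m+n)| > t} ≤ exp(−C t² / (n v² + M² + t M (log n)²))`,
then for every `η ∈ (0,1)`, with `γ = 1 + η`, there are constants `C' > 0`, `c > 0`
and `b ≥ 0` such that the maximal inequality
`P{M(m+1, m+n) > t} ≤ C' · exp(−c t² / (n + b t^γ))` holds, where
`M(m+1, m+n) = max_{m+1 ≤ j ≤ m+n} |S(m+1, j)|`. -/
theorem mpr_implies_maximal_bernstein
    {Ω : Type*} [MeasurableSpace Ω] (P : Measure Ω) [IsProbabilityMeasure P]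
    (X : ℕ → Ω → ℝ) (C v M : ℝ) (hC : 0 < C) (hv : 0 < v) (hM : 0 < M)
    (hMPR : ∀ (m n : ℕ), 1 ≤ n → ∀ t : ℝ, 0 ≤ t →
      P {ω | t < |∑ i ∈ Finset.Icc (m + 1) (m + n), X i ω|}
        ≤ ENNReal.ofReal
            (Real.exp (-(C * t ^ 2) /
              (n * v ^ 2 + M ^ 2 + t * M * (Real.log n) ^ 2)))) :
    ∀ η : ℝ, η ∈ Set.Ioo (0 : ℝ) 1 →
      ∃ C' c b : ℝ, 0 < C' ∧ 0 < c ∧ 0 ≤ b ∧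
        ∀ (m n : ℕ) (hn : 1 ≤ n), ∀ t : ℝ, 0 ≤ t →
          P {ω | t < (Finset.Icc (m + 1) (m + n)).sup'
                (Finset.nonempty_Icc.mpr (by omega))
                (fun j => |∑ i ∈ Finset.Icc (m + 1) j, X i ω|)}
            ≤ ENNReal.ofReal (C' * Real.exp (-(c * t ^ 2) / (n + b * t ^ (1 + η)))) := by
  intro η hη
  have hδ0 : 0 < η / 6 := by have := hη.1; positivity
  set r : ℝ := 2 ^ (-(η / 6)) with hr
  have hr0 : 0 < r := by positivity
  have hr1 : r < 1 := Real.rpow_lt_one_of_one_lt_of_neg one_lt_two (by linarith)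
  obtain ⟨D, c, hD, hc, hlevel⟩ :=
    exists_level_bound hC hv hM (sub_pos.2 hr1) hη
  refine ⟨2 * D + Real.exp c, c, 1, by positivity, hc, zero_le_one, fun m n hn t ht => ?_⟩
  rw [one_mul]
  have hn1 : (1 : ℝ) ≤ n := by exact_mod_cast hn
  rcases lt_or_ge (t ^ 2) (n : ℝ) with hsmall | hlarge
  · refine prob_le_one.trans ?_
    rw [← ENNReal.ofReal_one]
    apply ENNReal.ofReal_le_ofReal
    have hs : c * t ^ 2 / (n + t ^ (1 + η)) ≤ c := by
      have : 0 ≤ t ^ (1 + η) := by positivity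
      rw [div_le_iff₀ (by positivity)]
      gcongr
      linarith
    calc (1 : ℝ) ≤ Real.exp c * Real.exp (-(c * t ^ 2) / (n + t ^ (1 + η))) := by
          rw [← Real.exp_add, neg_div]
          exact Real.one_le_exp (by linarith)
      _ ≤ _ := by gcongr; linarith
  set K := Nat.log 2 n with hKdef
  have hKlow : 2 ^ K ≤ n := Nat.pow_log_le_self 2 (by omega)
  have hKup : n < 2 ^ (K + 1) := Nat.lt_pow_succ_log_self one_lt_two n
  have hry : ∀ L : ℕ, ((2 : ℝ) ^ L) ^ (-(η / 6)) = r ^ L := fun L => by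
    rw [hr, ← Real.rpow_natCast, ← Real.rpow_natCast, ← Real.rpow_mul two_pos.le,
      ← Real.rpow_mul two_pos.le, mul_comm]
  have hgeom : ∀ q : ℝ, 0 ≤ q → q < 1 → ∑ k ∈ range (K + 1), q ^ (K - k) ≤ (1 - q)⁻¹ := by
    intro q hq0 hq1
    have := sum_range_reflect (fun k => q ^ k) (K + 1)
    simp only [Nat.add_sub_cancel] at this
    rw [this]
    exact ((summable_geometric_of_lt_one hq0 hq1).sum_le_tsum _
      (fun _ _ => by positivity)).trans_eq (tsum_geometric_of_lt_one hq0 hq1)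
  set G := Real.exp (-(c * t ^ 2) / (n + t ^ (1 + η))) with hG
  refine (measure_lt_sup'_le_sum_dyadic P X (fun k => t * (1 - r) * r ^ (K - k))
    (fun k => by have := sub_pos.2 hr1; positivity) m n K _ hKup t ?_).trans ?_
  · rw [← mul_sum]
    calc t * (1 - r) * ∑ k ∈ range (K + 1), r ^ (K - k)
        ≤ t * (1 - r) * (1 - r)⁻¹ := by
          have := sub_pos.2 hr1
          gcongr
          exact hgeom r hr0.le hr1
      _ = t := by rw [mul_assoc, mul_inv_cancel₀ (sub_pos.2 hr1).ne', mul_one]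
  have hterm : ∀ k ∈ range (K + 1), ∑ a ∈ range (n / 2 ^ k),
      P {ω | t * (1 - r) * r ^ (K - k)
        < |∑ i ∈ Icc (m + a * 2 ^ k + 1) (m + a * 2 ^ k + 2 ^ k), X i ω|}
      ≤ ENNReal.ofReal (D * G * (1 / 2) ^ (K - k)) := by
    intro k hk
    have hkK : k + (K - k) = K := by rw [mem_range] at hk; omega
    have hprod : (2 : ℝ) ^ k * 2 ^ (K - k) = 2 ^ K := by rw [← pow_add, hkK]
    have hτ0 : 0 ≤ t * (1 - r) * r ^ (K - k) := by have := sub_pos.2 hr1; positivity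
    refine (sum_le_sum fun a _ =>
      hMPR (m + a * 2 ^ k) (2 ^ k) Nat.one_le_two_pow _ hτ0).trans ?_
    rw [sum_const, card_range, nsmul_eq_mul, ← ENNReal.ofReal_natCast,
      ← ENNReal.ofReal_mul (Nat.cast_nonneg _)]
    apply ENNReal.ofReal_le_ofReal
    have hb := hlevel n t (2 ^ (K - k)) (2 ^ k) (one_le_pow₀ one_le_two) (one_le_pow₀ one_le_two)
      ht hlarge (by rw [hprod]; exact_mod_cast hKlow)
      (by rw [hprod, ← pow_succ']; exact_mod_cast hKup.le)
    rw [hry] at hb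
    push_cast
    refine (mul_le_mul_of_nonneg_right ?_ (Real.exp_pos _).le).trans (hb.trans_eq ?_)
    · exact_mod_cast Nat.cast_div_le (α := ℝ) (m := n) (n := 2 ^ k)
    · rw [one_div, inv_pow]; ring
  refine (sum_le_sum hterm).trans ?_
  rw [← ENNReal.ofReal_sum_of_nonneg (fun k _ => by positivity), ← mul_sum]
  apply ENNReal.ofReal_le_ofReal
  calc D * G * ∑ k ∈ range (K + 1), (1 / 2 : ℝ) ^ (K - k) ≤ D * G * (1 - 1 / 2)⁻¹ := by
        gcongr
        exact hgeom _ (by norm_num) (by norm_num)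
    _ = 2 * D * G := by norm_num; ring
    _ ≤ _ := by gcongr; linarith [Real.exp_pos c]
end
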